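/- Let K be an algebraically closed field of characteristic zero and let n ≥ 2 be an integer. Then there exist a natural number m and a polynomial map φ : K^m → M_n(K) (into the space of n×n matrices over K, each matrix entry of φ being a polynomial function in m variables) whose image is exactly the special linear group SL_n(K) = {A ∈ M_n(K) : det A = 1}. In other words, SL_n(K) is the surjective image of an affine space under a morphism. -/

import Mathlib

/-- A set of matrices is polynomially covered if it lies in the image of a polynomial map from
an affine space to the matrices of determinant one, whose image contains the identity. -/
def PolyCovered {K ι : Type*} [Field K] [Fintype ι] [DecidableEq ι]
    (X : Set (Matrix ι ι K)) : Prop :=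
  ∃ (m : ℕ) (f : Matrix ι ι (MvPolynomial (Fin m) K)),
    (∀ v : Fin m → K, (f.map (MvPolynomial.eval v)).det = 1) ∧
      insert 1 X ⊆ Set.range fun v : Fin m → K => f.map (MvPolynomial.eval v)

namespace PolyCovered

open Matrix
open scoped Pointwise

variable {K ι : Type*} [Field K] [Fintype ι] [DecidableEq ι] {X Y : Set (Matrix ι ι K)}

theorem mono (hY : PolyCovered Y) (h : X ⊆ Y) : PolyCovered X := by
  obtain ⟨m, f, hf, hYf⟩ := hY
  exact ⟨m, f, hf, (Set.insert_subset_insert h).trans hYf⟩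

theorem insert_one (hX : PolyCovered X) : PolyCovered (insert 1 X) := by
  obtain ⟨m, f, hf, hXf⟩ := hX
  exact ⟨m, f, hf, by rwa [Set.insert_idem]⟩

theorem singleton_one : PolyCovered ({1} : Set (Matrix ι ι K)) :=
  ⟨0, 1, fun v => by simp [Matrix.map_one], by
    rintro _ (rfl | rfl) <;> exact ⟨0, by simp [Matrix.map_one]⟩⟩

theorem mul (hX : PolyCovered X) (hY : PolyCovered Y) : PolyCovered (X * Y) := by
  obtain ⟨m, f, hf, hXf⟩ := hX
  obtain ⟨k, g, hg, hYg⟩ := hY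
  have key : ∀ v : Fin (m + k) → K,
      (f.map (MvPolynomial.rename (Fin.castAdd k)) *
        g.map (MvPolynomial.rename (Fin.natAdd m))).map (MvPolynomial.eval v) =
      f.map (MvPolynomial.eval fun i => v (Fin.castAdd k i)) *
        g.map (MvPolynomial.eval fun i => v (Fin.natAdd m i)) := by
    intro v
    rw [Matrix.map_mul]
    congr 1 <;> ext i j <;> simp [MvPolynomial.eval_rename, Function.comp_def]
  refine ⟨m + k, _, fun v => by rw [key, det_mul, hf, hg, one_mul], ?_⟩
  have hprod : ∀ A ∈ insert 1 X, ∀ B ∈ insert 1 Y, A * B ∈ Set.range fun v : Fin (m + k) → K =>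
      (f.map (MvPolynomial.rename (Fin.castAdd k)) *
        g.map (MvPolynomial.rename (Fin.natAdd m))).map (MvPolynomial.eval v) := by
    intro A hA B hB
    obtain ⟨v, rfl⟩ := hXf hA
    obtain ⟨w, rfl⟩ := hYg hB
    exact ⟨Fin.append v w, by simp only [key, Fin.append_left, Fin.append_right]⟩
  rintro _ (rfl | ⟨A, hA, B, hB, rfl⟩)
  · simpa only [one_mul] using hprod 1 (Set.mem_insert _ _) 1 (Set.mem_insert _ _)
  · exact hprod A (Set.mem_insert_of_mem _ hA) B (Set.mem_insert_of_mem _ hB)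

theorem union (hX : PolyCovered X) (hY : PolyCovered Y) : PolyCovered (X ∪ Y) := by
  refine (hX.insert_one.mul hY.insert_one).mono ?_
  rintro A (hA | hA)
  · exact ⟨A, .inr hA, 1, .inl rfl, mul_one A⟩
  · exact ⟨1, .inl rfl, A, .inr hA, one_mul A⟩

theorem biUnion {α : Type*} (s : Finset α) {F : α → Set (Matrix ι ι K)}
    (h : ∀ a ∈ s, PolyCovered (F a)) : PolyCovered (⋃ a ∈ s, F a) := by
  classical
  induction s using Finset.induction_on with
  | empty => exact singleton_one.mono (by simp)
  | insert a s _ ih =>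
    rw [Finset.set_biUnion_insert]
    exact (h a (Finset.mem_insert_self a s)).union
      (ih fun b hb => h b (Finset.mem_insert_of_mem hb))

theorem range_transvection {i j : ι} (hij : i ≠ j) :
    PolyCovered (Set.range fun c : K => transvection i j c) := by
  have key : ∀ v : Fin 1 → K,
      (transvection i j (MvPolynomial.X 0)).map (MvPolynomial.eval v) =
        transvection i j (v 0) := by
    intro v
    ext a b
    simp only [transvection, map_apply, Matrix.add_apply, one_apply, single_apply, map_add]
    split_ifs <;> simp
  refine ⟨1, _, fun v => by rw [key, det_transvection_of_ne i j hij], ?_⟩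
  rintro _ (rfl | ⟨c, rfl⟩)
  · exact ⟨0, by simp only [key, Pi.zero_apply, transvection_zero]⟩
  · exact ⟨fun _ => c, key _⟩

theorem of_transvection_mul {i j : ι} (hij : i ≠ j) (hY : PolyCovered Y)
    (h : ∀ A ∈ X, ∃ c : K, transvection i j c * A ∈ Y) : PolyCovered X := by
  refine ((range_transvection hij).mul hY).mono fun A hA => ?_
  obtain ⟨c, hc⟩ := h A hA
  refine ⟨_, ⟨-c, rfl⟩, _, hc, ?_⟩
  simp [← mul_assoc, transvection_mul_transvection_same i j hij]

theorem of_mul_transvection {i j : ι} (hij : i ≠ j) (hY : PolyCovered Y)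
    (h : ∀ A ∈ X, ∃ c : K, A * transvection i j c ∈ Y) : PolyCovered X := by
  refine (hY.mul (range_transvection hij)).mono fun A hA => ?_
  obtain ⟨c, hc⟩ := h A hA
  refine ⟨_, hc, _, ⟨-c, rfl⟩, ?_⟩
  simp [mul_assoc, transvection_mul_transvection_same i j hij]

end PolyCovered

namespace Matrix

variable {K ι : Type*} [Field K] [Fintype ι] [DecidableEq ι]

/-- The matrices of determinant one which agree with the identity outside `s × s`. -/
def supportedSL (K : Type*) [Field K] (s : Finset ι) : Set (Matrix ι ι K) :=
  {A | A.det = 1 ∧ ∀ i j, i ∉ s ∨ j ∉ s → A i j = (1 : Matrix ι ι K) i j}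

theorem transvection_mul_mem_supportedSL {s : Finset ι} {A : Matrix ι ι K}
    (hA : A ∈ supportedSL K s) {i j : ι} (hi : i ∈ s) (hj : j ∈ s) (hij : i ≠ j) (c : K) :
    transvection i j c * A ∈ supportedSL K s := by
  refine ⟨by rw [det_mul, det_transvection_of_ne i j hij, hA.1, one_mul], fun a b hab => ?_⟩
  by_cases ha : a = i
  · subst ha
    have hb : b ∉ s := by tauto
    have hjb : j ≠ b := fun h => hb (h ▸ hj)
    rw [transvection_mul_apply_same, hA.2 a b hab, hA.2 j b (.inr hb), one_apply_ne hjb,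
      mul_zero, add_zero]
  · rw [transvection_mul_apply_of_ne _ _ _ _ ha, hA.2 a b hab]

theorem mul_transvection_mem_supportedSL {s : Finset ι} {A : Matrix ι ι K}
    (hA : A ∈ supportedSL K s) {i j : ι} (hi : i ∈ s) (hj : j ∈ s) (hij : i ≠ j) (c : K) :
    A * transvection i j c ∈ supportedSL K s := by
  refine ⟨by rw [det_mul, det_transvection_of_ne i j hij, hA.1, one_mul], fun a b hab => ?_⟩
  by_cases hb : b = j
  · subst hb
    have ha : a ∉ s := by tauto
    have hai : a ≠ i := fun h => ha (h ▸ hi)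
    rw [mul_transvection_apply_same, hA.2 a b hab, hA.2 a i (.inl ha), one_apply_ne hai,
      mul_zero, add_zero]
  · rw [mul_transvection_apply_of_ne _ _ _ _ hb, hA.2 a b hab]

theorem polyCovered_clear_row {k : ι} {s : Finset ι} (hk : k ∉ s)
    (hs : PolyCovered (supportedSL K s)) (t : Finset ι) (ht : t ⊆ s) :
    PolyCovered {A ∈ supportedSL K (insert k s) | A k k = 1 ∧ (∀ j ∈ s, A j k = 0) ∧
      ∀ j ∈ s, j ∉ t → A k j = 0} := by
  induction t using Finset.induction_on with
  | empty =>
    refine hs.mono ?_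
    rintro A ⟨hA, hkk, hcol, hrow⟩
    refine ⟨hA.1, fun i j hij => ?_⟩
    by_cases hout : i ∉ insert k s ∨ j ∉ insert k s
    · exact hA.2 i j hout
    · simp only [Finset.mem_insert, not_or, not_and_or, not_not] at hout
      obtain ⟨rfl | hi, rfl | hj⟩ := hout
      · rw [hkk, one_apply_eq]
      · rw [hrow j hj (Finset.notMem_empty j), one_apply_ne (ne_of_mem_of_not_mem hj hk).symm]
      · rw [hcol i hi, one_apply_ne (ne_of_mem_of_not_mem hi hk)]
      · tauto
  | insert l t _ ih =>
    have hl : l ∈ s := ht (Finset.mem_insert_self l t)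
    have hkl : k ≠ l := fun h => hk (h ▸ hl)
    refine (ih ((Finset.subset_insert l t).trans ht)).of_mul_transvection hkl ?_
    rintro A ⟨hA, hkk, hcol, hrow⟩
    refine ⟨-A k l, mul_transvection_mem_supportedSL hA (Finset.mem_insert_self k s)
      (Finset.mem_insert_of_mem hl) hkl _, ?_, fun j hj => ?_, fun j hj hjt => ?_⟩
    · rw [mul_transvection_apply_of_ne _ _ _ _ hkl, hkk]
    · rw [mul_transvection_apply_of_ne _ _ _ _ hkl, hcol j hj]
    · by_cases hjl : j = l
      · subst hjl
        rw [mul_transvection_apply_same, hkk]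
        ring
      · rw [mul_transvection_apply_of_ne _ _ _ _ hjl, hrow j hj (by simp [hjl, hjt])]

theorem polyCovered_clear_col {k : ι} {s : Finset ι} (hk : k ∉ s)
    (hs : PolyCovered (supportedSL K s)) (t : Finset ι) (ht : t ⊆ s) :
    PolyCovered {A ∈ supportedSL K (insert k s) | A k k = 1 ∧
      ∀ j ∈ s, j ∉ t → A j k = 0} := by
  induction t using Finset.induction_on with
  | empty =>
    refine (polyCovered_clear_row hk hs s subset_rfl).mono ?_
    rintro A ⟨hA, hkk, hcol⟩
    exact ⟨hA, hkk, fun j hj => hcol j hj (Finset.notMem_empty j),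
      fun j hj hjs => absurd hj hjs⟩
  | insert l t _ ih =>
    have hl : l ∈ s := ht (Finset.mem_insert_self l t)
    have hlk : l ≠ k := fun h => hk (h ▸ hl)
    refine (ih ((Finset.subset_insert l t).trans ht)).of_transvection_mul hlk ?_
    rintro A ⟨hA, hkk, hcol⟩
    refine ⟨-A l k, transvection_mul_mem_supportedSL hA (Finset.mem_insert_of_mem hl)
      (Finset.mem_insert_self k s) hlk _, ?_, fun j hj hjt => ?_⟩
    · rw [transvection_mul_apply_of_ne _ _ _ _ hlk.symm, hkk]
    · by_cases hjl : j = l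
      · subst hjl
        rw [transvection_mul_apply_same, hkk]
        ring
      · rw [transvection_mul_apply_of_ne _ _ _ _ hjl, hcol j hj (by simp [hjl, hjt])]

theorem polyCovered_of_apply_ne_zero {k : ι} {s : Finset ι} (hk : k ∉ s)
    (hs : PolyCovered (supportedSL K s)) {l : ι} (hl : l ∈ s) :
    PolyCovered {A ∈ supportedSL K (insert k s) | A l k ≠ 0} := by
  have hkl : k ≠ l := fun h => hk (h ▸ hl)
  refine (polyCovered_clear_col hk hs s subset_rfl).of_transvection_mul hkl ?_
  rintro A ⟨hA, hlk⟩
  refine ⟨(1 - A k k) / A l k, transvection_mul_mem_supportedSL hA (Finset.mem_insert_self k s)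
    (Finset.mem_insert_of_mem hl) hkl _, ?_, fun j hj hjs => absurd hj hjs⟩
  rw [transvection_mul_apply_same]
  field_simp
  ring

/-- Gaussian elimination with a uniformly bounded number of transvections. -/
theorem polyCovered_supportedSL (s : Finset ι) : PolyCovered (supportedSL K s) := by
  induction s using Finset.induction_on with
  | empty =>
    refine PolyCovered.singleton_one.mono fun A hA => ?_
    ext i j
    exact hA.2 i j (.inl (Finset.notMem_empty i))
  | insert k s hk ih =>
    have col_ne : ∀ A ∈ supportedSL K (insert k s), (∀ j ∈ s, A j k = 0) → A k k ≠ 0 := by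
      intro A hA hcol hkk
      refine one_ne_zero (α := K) (hA.1.symm.trans (det_eq_zero_of_column_eq_zero k fun i => ?_))
      by_cases hi : i ∈ insert k s
      · obtain rfl | hi := Finset.mem_insert.1 hi
        exacts [hkk, hcol i hi]
      · rw [hA.2 i k (.inl hi), one_apply_ne]
        rintro rfl
        exact hi (Finset.mem_insert_self i s)
    obtain rfl | ⟨l, hl⟩ := s.eq_empty_or_nonempty
    · refine PolyCovered.singleton_one.mono fun A hA => ?_
      have hoff : ∀ i j, i ≠ k ∨ j ≠ k → A i j = (1 : Matrix ι ι K) i j := fun i j h =>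
        hA.2 i j (by simpa using h)
      have hdiag : A = diagonal fun i => A i i := by
        ext i j
        by_cases hij : i = j
        · subst hij
          simp
        · rw [diagonal_apply_ne _ hij, hoff i j (by grind), one_apply_ne hij]
      have hkk : A k k = 1 := by
        have hdet := hA.1
        rw [hdiag, det_diagonal, Finset.prod_eq_single k
          (fun i _ hi => by rw [hoff i i (.inl hi), one_apply_eq]) (by simp)] at hdet
        exact hdet
      ext i j
      by_cases h : i ≠ k ∨ j ≠ k
      · exact hoff i j h
      · obtain ⟨rfl, rfl⟩ : i = k ∧ j = k := by simpa [not_or] using h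
        rw [hkk, one_apply_eq]
    · have hlk : l ≠ k := fun h => hk (h ▸ hl)
      have hzero : PolyCovered {A ∈ supportedSL K (insert k s) | ∀ j ∈ s, A j k = 0} := by
        refine (polyCovered_of_apply_ne_zero hk ih hl).of_transvection_mul hlk ?_
        rintro A ⟨hA, hcol⟩
        refine ⟨1, transvection_mul_mem_supportedSL hA (Finset.mem_insert_of_mem hl)
          (Finset.mem_insert_self k s) hlk _, ?_⟩
        rw [transvection_mul_apply_same, hcol l hl, zero_add, one_mul]
        exact col_ne A hA hcol
      refine (hzero.union (PolyCovered.biUnion s fun l hl =>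
        polyCovered_of_apply_ne_zero hk ih hl)).mono fun A hA => ?_
      by_cases hcol : ∀ j ∈ s, A j k = 0
      · exact .inl ⟨hA, hcol⟩
      · push Not at hcol
        obtain ⟨j, hj, hjk⟩ := hcol
        exact .inr (Set.mem_biUnion (Finset.mem_coe.2 hj) ⟨hA, hjk⟩)

end Matrix

/-- For `n ≥ 2`, the special linear group `SLₙ(K)` is the image of a polynomial map from
an affine space into the space of `n × n` matrices. -/
theorem stmt_11 (K : Type*) [Field K] [IsAlgClosed K] [CharZero K] (n : ℕ) (hn : 2 ≤ n) :
    ∃ (m : ℕ) (f : Fin n → Fin n → MvPolynomial (Fin m) K),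
      Set.range (fun v : Fin m → K =>
          Matrix.of (fun i j : Fin n => MvPolynomial.eval v (f i j))) =
        {A : Matrix (Fin n) (Fin n) K | A.det = 1} := by
  obtain ⟨m, f, hdet, hcov⟩ :=
    Matrix.polyCovered_supportedSL (K := K) (Finset.univ : Finset (Fin n))
  refine ⟨m, f, Set.Subset.antisymm ?_ fun A hA => ?_⟩
  · rintro _ ⟨v, rfl⟩
    exact hdet v
  · exact hcov (.inr ⟨hA, by simp⟩)
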